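/- Let 𝒜 be an f-algebra with a multiplicative unit e, and suppose there exists a norm on 𝒜 under which 𝒜 is a Banach lattice (a complete norm satisfying |a| ≤ |b| ⇒ ‖a‖ ≤ ‖b‖). Then the multiplicative unit e is an order unit in 𝒜, and Φ₁(𝒜) = Φ₂(𝒜) = Φ₃(𝒜) = 𝒜. -/

import Mathlib

namespace FiniteElementsPaper

/-- Product of `p` factors `φ 0 * φ 1 * ⋯ * φ (p-1)` in a (possibly non-unital)
multiplicative structure; junk value `0` when `p = 0`. -/
def mulProd {A : Type*} [Mul A] [Zero A] : (p : ℕ) → (Fin p → A) → A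
  | 0, _ => 0
  | q + 1, φ => Fin.foldl q (fun acc i => acc * φ i.succ) (φ 0)

/-- `p`-th power `a^p` (junk value `0` for `p = 0`). -/
def mpow {A : Type*} [Mul A] [Zero A] (a : A) (p : ℕ) : A :=
  mulProd p (fun _ => a)

/-- The set `Π_p(𝒜)` of all `p`-fold products. -/
def piSet (A : Type*) [Mul A] [Zero A] (p : ℕ) : Set A :=
  {x | ∃ φ : Fin p → A, x = mulProd p φ}

variable {A : Type*} [Lattice A] [AddCommGroup A] [Module ℝ A]

/-- `z` is a majorant of `φ`: `z ≥ 0` and for every `x` there is `c > 0` with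
`|x| ⊓ n • |φ| ≤ c • z` for all `n`. -/
def IsMajorant (z φ : A) : Prop :=
  0 ≤ z ∧ ∀ x : A, ∃ c : ℝ, 0 < c ∧ ∀ n : ℕ, |x| ⊓ n • |φ| ≤ c • z

/-- `φ` is a finite element. -/
def IsFiniteElt (φ : A) : Prop := ∃ z : A, IsMajorant z φ

/-- `φ` is a totally finite element: it has a majorant which is itself finite. -/
def IsTotallyFiniteElt (φ : A) : Prop := ∃ z : A, IsMajorant z φ ∧ IsFiniteElt z

/-- `φ` is self-majorizing: `|φ|` is a majorant of `φ`. -/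
def IsSelfMajorizing (φ : A) : Prop := IsMajorant |φ| φ

/-- `φ ∈ Φ₃(A) = S₊(A) - S₊(A)`. -/
def InPhi3 (φ : A) : Prop :=
  ∃ s t : A, 0 ≤ s ∧ 0 ≤ t ∧ IsSelfMajorizing s ∧ IsSelfMajorizing t ∧ φ = s - t

/-- `w` is a majorant of `φ` relative to the subset `S` (all lattice operations
computed in the ambient algebra). -/
def IsMajorantIn (S : Set A) (w φ : A) : Prop :=
  0 ≤ w ∧ ∀ x ∈ S, ∃ c : ℝ, 0 < c ∧ ∀ n : ℕ, |x| ⊓ n • |φ| ≤ c • w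

/-- `φ` is a finite element of the sublattice `S` (majorant required to lie in `S`). -/
def IsFiniteEltIn (S : Set A) (φ : A) : Prop := ∃ w ∈ S, IsMajorantIn S w φ

/-- `φ` is a totally finite element of the sublattice `S`. -/
def IsTotallyFiniteEltIn (S : Set A) (φ : A) : Prop :=
  ∃ w ∈ S, IsMajorantIn S w φ ∧ IsFiniteEltIn S w

/-- `φ` is self-majorizing in the sublattice `S`. -/
def IsSelfMajorizingIn (S : Set A) (φ : A) : Prop := IsMajorantIn S |φ| φ

/-- `φ ∈ Φ₃(S) = S₊(S) - S₊(S)` for the sublattice `S`. -/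
def InPhi3In (S : Set A) (φ : A) : Prop :=
  ∃ s t : A, s ∈ S ∧ t ∈ S ∧ 0 ≤ s ∧ 0 ≤ t ∧
    IsSelfMajorizingIn S s ∧ IsSelfMajorizingIn S t ∧ φ = s - t

variable (A) in
/-- Archimedean ℓ-algebra structure: an Archimedean vector lattice together with an
associative bilinear multiplication whose product of positive elements is positive. -/
structure IsLAlgebra [Mul A] : Prop where
  add_le_add_left : ∀ a b : A, a ≤ b → ∀ c : A, c + a ≤ c + b
  smul_le_smul : ∀ (r : ℝ) (a b : A), 0 ≤ r → a ≤ b → r • a ≤ r • b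
  archimedean : ∀ a b : A, 0 ≤ a → (∀ n : ℕ, n • a ≤ b) → a = 0
  mul_assoc : ∀ a b c : A, a * b * c = a * (b * c)
  left_distrib : ∀ a b c : A, a * (b + c) = a * b + a * c
  right_distrib : ∀ a b c : A, (a + b) * c = a * c + b * c
  smul_mul : ∀ (r : ℝ) (a b : A), (r • a) * b = r • (a * b)
  mul_smul : ∀ (r : ℝ) (a b : A), a * (r • b) = r • (a * b)
  mul_nonneg : ∀ a b : A, 0 ≤ a → 0 ≤ b → 0 ≤ a * b

variable (A) in
/-- A `d`-algebra: ℓ-algebra in which `a ⊓ b = 0` implies `(a*c) ⊓ (b*c) = (c*a) ⊓ (c*b) = 0`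
for all `c ≥ 0`. -/
structure IsDAlgebra [Mul A] extends IsLAlgebra A : Prop where
  d_prop : ∀ a b c : A, a ⊓ b = 0 → 0 ≤ c → (a * c) ⊓ (b * c) = 0 ∧ (c * a) ⊓ (c * b) = 0

variable (A) in
/-- An `f`-algebra: ℓ-algebra in which `a ⊓ b = 0` implies `(a*c) ⊓ b = (c*a) ⊓ b = 0`
for all `c ≥ 0`. -/
structure IsFAlgebra [Mul A] extends IsLAlgebra A : Prop where
  f_prop : ∀ a b c : A, a ⊓ b = 0 → 0 ≤ c → (a * c) ⊓ b = 0 ∧ (c * a) ⊓ b = 0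

/-- `e` is a multiplicative unit. -/
def IsMulUnit [Mul A] (e : A) : Prop := ∀ a : A, a * e = a ∧ e * a = a

/-- `e` is an order unit. -/
def IsOrderUnit (e : A) : Prop := 0 ≤ e ∧ ∀ x : A, ∃ l : ℝ, 0 ≤ l ∧ |x| ≤ l • e

variable (A) in
/-- The algebra is semiprime: `0` is its only nilpotent element. -/
def IsSemiprime [Mul A] [Zero A] : Prop :=
  ∀ (a : A) (n : ℕ), 0 < n → mpow a n = 0 → a = 0

variable (A) in
/-- The vector lattice is uniformly complete. -/
def UniformlyComplete : Prop :=
  ∀ u : A, 0 ≤ u → ∀ f : ℕ → A,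
    (∀ ε : ℝ, 0 < ε → ∃ K : ℕ, ∀ m n : ℕ, K ≤ m → K ≤ n → |f m - f n| ≤ ε • u) →
    ∃ a : A, ∀ ε : ℝ, 0 < ε → ∃ K : ℕ, ∀ n : ℕ, K ≤ n → |f n - a| ≤ ε • u

variable (A) in
/-- The weak factorization property: every element is dominated by a product. -/
def WeakFactorization [Mul A] : Prop := ∀ a : A, ∃ b c : A, a ≤ b * c


theorem IsLAlgebra.isOrderedAddMonoid [Mul A] (hA : IsLAlgebra A) : IsOrderedAddMonoid A where
  add_le_add_left a b h c := by
    simpa only [add_comm] using hA.add_le_add_left a b h c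

theorem IsLAlgebra.posSMulMono [Mul A] (hA : IsLAlgebra A) : PosSMulMono ℝ A where
  smul_le_smul_of_nonneg_left r hr a b h := hA.smul_le_smul r a b hr h

theorem IsLAlgebra.sub_mul [Mul A] (hA : IsLAlgebra A) (a b c : A) :
    (a - b) * c = a * c - b * c := by
  rw [eq_sub_iff_add_eq, ← hA.right_distrib, sub_add_cancel]

theorem IsLAlgebra.mul_sub [Mul A] (hA : IsLAlgebra A) (a b c : A) :
    a * (b - c) = a * b - a * c := by
  rw [eq_sub_iff_add_eq, ← hA.left_distrib, sub_add_cancel]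

theorem IsLAlgebra.mul_le_mul_left [Mul A] (hA : IsLAlgebra A) {a b c : A} (ha : 0 ≤ a)
    (h : b ≤ c) : a * b ≤ a * c := by
  have := hA.isOrderedAddMonoid
  rw [← sub_nonneg, ← hA.mul_sub]
  exact hA.mul_nonneg _ _ ha (sub_nonneg.2 h)

/-- Disjoint elements of an f-algebra have product zero. -/
theorem IsFAlgebra.mul_eq_zero_of_inf_eq_zero [Mul A] (hA : IsFAlgebra A) {a b : A}
    (h : a ⊓ b = 0) : a * b = 0 := by
  have ha : 0 ≤ a := h ▸ inf_le_left
  have hb : 0 ≤ b := h ▸ inf_le_right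
  have h₁ : b ⊓ (a * b) = 0 := by
    rw [inf_comm]
    exact (hA.f_prop a b b h hb).1
  simpa using (hA.f_prop b (a * b) a h₁ ha).2

theorem IsFAlgebra.negPart_mul_posPart [Mul A] (hA : IsFAlgebra A) (a : A) : a⁻ * a⁺ = 0 := by
  have := hA.isOrderedAddMonoid
  exact hA.mul_eq_zero_of_inf_eq_zero (by rw [inf_comm, posPart_inf_negPart_eq_zero])

theorem IsFAlgebra.mul_posPart_self [Mul A] (hA : IsFAlgebra A) (a : A) :
    a * a⁺ = a⁺ * a⁺ := by
  have := hA.isOrderedAddMonoid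
  have h := hA.sub_mul a⁺ a⁻ a⁺
  rwa [posPart_sub_negPart, hA.negPart_mul_posPart, sub_zero] at h

theorem IsFAlgebra.mulUnit_nonneg [Mul A] (hA : IsFAlgebra A) {e : A} (he : IsMulUnit e) :
    0 ≤ e := by
  have := hA.isOrderedAddMonoid
  have h := hA.sub_mul e⁺ e⁻ e⁻
  rw [posPart_sub_negPart, hA.mul_eq_zero_of_inf_eq_zero (posPart_inf_negPart_eq_zero e),
    zero_sub, (he _).2] at h
  have h₀ : e⁻ ≤ 0 := by
    rw [h]
    exact neg_nonpos.2 (hA.mul_nonneg _ _ (negPart_nonneg e) (negPart_nonneg e))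
  exact negPart_eq_zero.1 (le_antisymm h₀ (negPart_nonneg e))

/-- `a` acts on `(a - r • e)⁺` as an element that is at least `r`. -/
theorem IsFAlgebra.smul_posPart_sub_smul_le_mul [Mul A] (hA : IsFAlgebra A) {e : A}
    (he : IsMulUnit e) (a : A) (r : ℝ) : r • (a - r • e)⁺ ≤ a * (a - r • e)⁺ := by
  have := hA.isOrderedAddMonoid
  have h := hA.mul_posPart_self (a - r • e)
  have h₀ := hA.mul_nonneg _ _ (posPart_nonneg (a - r • e)) (posPart_nonneg (a - r • e))
  rwa [← h, hA.sub_mul, hA.smul_mul, (he _).2, sub_nonneg] at h₀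

/-- In a space with a complete Riesz norm, a positive sequence with `N (u n) ≤ 2⁻ⁿ` has an
upper bound (for instance its sum). -/
theorem exists_upperBound_of_complete_rieszNorm {E : Type*} [Lattice E] [AddCommGroup E]
    [IsOrderedAddMonoid E] (N : E → ℝ)
    (hN0 : ∀ x : E, N x = 0 ↔ x = 0)
    (hNadd : ∀ x y : E, N (x + y) ≤ N x + N y)
    (hNriesz : ∀ x y : E, |x| ≤ |y| → N x ≤ N y)
    (hNcomplete : ∀ f : ℕ → E,
      (∀ ε : ℝ, 0 < ε → ∃ K : ℕ, ∀ m n : ℕ, K ≤ m → K ≤ n → N (f m - f n) < ε) →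
      ∃ a : E, ∀ ε : ℝ, 0 < ε → ∃ K : ℕ, ∀ n : ℕ, K ≤ n → N (f n - a) < ε)
    (u : ℕ → E) (hu : ∀ n, 0 ≤ u n) (hNu : ∀ n, N (u n) ≤ (1 / 2) ^ n) :
    ∃ x : E, ∀ n, u n ≤ x := by
  have hneg (x : E) : N (-x) = N x :=
    le_antisymm (hNriesz _ _ (abs_neg x).le) (hNriesz _ _ (abs_neg x).ge)
  have hnonneg (x : E) : 0 ≤ N x := by
    have h := hNriesz 0 x (by simp)
    rwa [(hN0 0).2 rfl] at h
  let s : ℕ → E := fun n => ∑ i ∈ Finset.range n, u i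
  have htail (n k : ℕ) : N (s (n + k) - s n) ≤ 2 * (1 / 2) ^ n - 2 * (1 / 2) ^ (n + k) := by
    induction k with
    | zero => simp [(hN0 0).2 rfl]
    | succ k ih =>
      have h₁ : s (n + (k + 1)) - s n = (s (n + k) - s n) + u (n + k) := by
        simp only [s, ← add_assoc, Finset.sum_range_succ]
        abel
      have h₂ := hNadd (s (n + k) - s n) (u (n + k))
      have h₃ := hNu (n + k)
      have h₄ : (1 / 2 : ℝ) ^ (n + (k + 1)) = (1 / 2) ^ (n + k) * (1 / 2) := by
        rw [← add_assoc, pow_succ]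
      rw [h₁, h₄]
      linarith
  have htail' (K m : ℕ) (h : K ≤ m) : N (s m - s K) ≤ 2 * (1 / 2) ^ K := by
    obtain ⟨k, rfl⟩ := Nat.exists_eq_add_of_le h
    have h₁ := htail K k
    have h₂ : (0 : ℝ) < (1 / 2) ^ (K + k) := by positivity
    linarith
  obtain ⟨x, hx⟩ := hNcomplete s fun ε hε => by
    obtain ⟨K, hK⟩ := exists_pow_lt_of_lt_one (show 0 < ε / 4 by linarith)
      (show (1 / 2 : ℝ) < 1 by norm_num)
    refine ⟨K, fun m n hm hn => ?_⟩
    have h₁ := hNadd (s m - s K) (-(s n - s K))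
    rw [hneg, show s m - s K + -(s n - s K) = s m - s n by abel] at h₁
    have h₂ := htail' K m hm
    have h₃ := htail' K n hn
    linarith
  refine ⟨x, fun n => ?_⟩
  have hzero : N (u n - x)⁺ = 0 := by
    refine le_antisymm (le_of_forall_pos_lt_add fun ε hε => ?_) (hnonneg _)
    obtain ⟨K, hK⟩ := hx ε hε
    let m := max K (n + 1)
    have hm : u n ≤ s m :=
      Finset.single_le_sum (fun i _ => hu i)
        (Finset.mem_range.2 (lt_of_lt_of_le n.lt_succ_self (le_max_right _ _)))
    have hle : (u n - x)⁺ ≤ |s m - x| :=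
      sup_le ((sub_le_sub_right hm x).trans (le_abs_self _)) (abs_nonneg _)
    have h := hNriesz (u n - x)⁺ (s m - x) (by rwa [abs_of_nonneg (posPart_nonneg _)])
    rw [zero_add]
    exact h.trans_lt (hK m (le_max_left _ _))
  exact sub_nonpos.1 (posPart_eq_zero.1 ((hN0 _).1 hzero))

theorem IsOrderUnit.isMajorant_of_le [IsOrderedAddMonoid A] [PosSMulMono ℝ A] {e z : A}
    (he : IsOrderUnit e) (h : e ≤ z) (φ : A) : IsMajorant z φ := by
  refine ⟨he.1.trans h, fun x => ?_⟩
  obtain ⟨l, hl, hx⟩ := he.2 x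
  refine ⟨l + 1, by linarith, fun n => inf_le_left.trans (hx.trans ?_)⟩
  have h₁ : l • e ≤ l • z := smul_le_smul_of_nonneg_left h hl
  rw [add_smul, one_smul]
  exact h₁.trans (le_add_of_nonneg_right (he.1.trans h))

theorem IsOrderUnit.isSelfMajorizing_add [IsOrderedAddMonoid A] [PosSMulMono ℝ A] {e a : A}
    (he : IsOrderUnit e) (ha : 0 ≤ a) : IsSelfMajorizing (a + e) :=
  he.isMajorant_of_le ((le_add_of_nonneg_left ha).trans (le_abs_self _)) _

/-- An f-algebra with multiplicative unit `e` admitting a complete Riesz norm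
(a Banach lattice norm): `e` is an order unit and `Φ₁(𝒜) = Φ₂(𝒜) = Φ₃(𝒜) = 𝒜`. -/
theorem stmt6 {A : Type*} [Lattice A] [AddCommGroup A] [Module ℝ A] [Mul A]
    (hA : IsFAlgebra A) (e : A) (hunit : IsMulUnit e)
    (N : A → ℝ)
    (hN0 : ∀ x : A, N x = 0 ↔ x = 0)
    (hNsmul : ∀ (r : ℝ) (x : A), N (r • x) = |r| * N x)
    (hNadd : ∀ x y : A, N (x + y) ≤ N x + N y)
    (hNriesz : ∀ x y : A, |x| ≤ |y| → N x ≤ N y)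
    (hNcomplete : ∀ f : ℕ → A,
      (∀ ε : ℝ, 0 < ε → ∃ K : ℕ, ∀ m n : ℕ, K ≤ m → K ≤ n → N (f m - f n) < ε) →
      ∃ a : A, ∀ ε : ℝ, 0 < ε → ∃ K : ℕ, ∀ n : ℕ, K ≤ n → N (f n - a) < ε) :
    IsOrderUnit e ∧ ∀ a : A, IsFiniteElt a ∧ IsTotallyFiniteElt a ∧ InPhi3 a := by
  have := hA.isOrderedAddMonoid
  have := hA.posSMulMono
  have he0 : 0 ≤ e := hA.mulUnit_nonneg hunit
  have hnonneg (x : A) : 0 ≤ N x := by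
    have h := hNriesz 0 x (by simp)
    rwa [(hN0 0).2 rfl] at h
  have hmono (x y : A) (hx : 0 ≤ x) (hxy : x ≤ y) : N x ≤ N y :=
    hNriesz x y (by rwa [abs_of_nonneg hx, abs_of_nonneg (hx.trans hxy)])
  have hbound (a : A) (ha : 0 ≤ a) : ∃ n : ℕ, a ≤ (4 ^ n : ℝ) • e := by
    by_contra! hcon
    let w : ℕ → A := fun n => (a - (4 ^ n : ℝ) • e)⁺
    have hw0 (n : ℕ) : 0 ≤ w n := posPart_nonneg _
    have hwN (n : ℕ) : 0 < N (w n) := by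
      refine lt_of_le_of_ne (hnonneg _) fun h => hcon n ?_
      exact sub_nonpos.1 (posPart_eq_zero.1 ((hN0 _).1 h.symm))
    let c : ℕ → ℝ := fun n => (1 / 2) ^ n / N (w n)
    have hc (n : ℕ) : 0 ≤ c n := div_nonneg (by positivity) (hnonneg _)
    have hu0 (n : ℕ) : 0 ≤ c n • w n := smul_nonneg (hc n) (hw0 n)
    have huN (n : ℕ) : N (c n • w n) = (1 / 2) ^ n := by
      rw [hNsmul, abs_of_nonneg (hc n)]
      exact div_mul_cancel₀ _ (hwN n).ne'
    obtain ⟨x, hx⟩ := exists_upperBound_of_complete_rieszNorm N hN0 hNadd hNriesz hNcomplete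
      (fun n => c n • w n) hu0 fun n => (huN n).le
    have hlarge (n : ℕ) : (2 : ℝ) ^ n ≤ N (a * x) := by
      have h₁ : (4 ^ n : ℝ) • c n • w n ≤ a * (c n • w n) := by
        rw [hA.mul_smul, smul_comm]
        exact smul_le_smul_of_nonneg_left (hA.smul_posPart_sub_smul_le_mul hunit a _) (hc n)
      have h₂ := hmono _ _ (smul_nonneg (by positivity) (hu0 n))
        (h₁.trans (hA.mul_le_mul_left ha (hx n)))
      rw [hNsmul, huN, abs_of_nonneg (by positivity), ← mul_pow] at h₂
      norm_num at h₂
      exact h₂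
    obtain ⟨n, hn⟩ := pow_unbounded_of_one_lt (N (a * x)) (one_lt_two (α := ℝ))
    exact absurd (hlarge n) hn.not_ge
  have he : IsOrderUnit e := by
    refine ⟨he0, fun x => ?_⟩
    obtain ⟨n, hn⟩ := hbound |x| (abs_nonneg x)
    exact ⟨4 ^ n, by positivity, hn⟩
  refine ⟨he, fun a => ⟨⟨e, he.isMajorant_of_le le_rfl a⟩,
    ⟨e, he.isMajorant_of_le le_rfl a, e, he.isMajorant_of_le le_rfl e⟩, ?_⟩⟩
  refine ⟨a⁺ + e, a⁻ + e, add_nonneg (posPart_nonneg a) he0, add_nonneg (negPart_nonneg a) he0,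
    he.isSelfMajorizing_add (posPart_nonneg a), he.isSelfMajorizing_add (negPart_nonneg a), ?_⟩
  rw [add_sub_add_right_eq_sub, posPart_sub_negPart]

end FiniteElementsPaper
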